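/- Let Z be the 7-vertex graph obtained from a 4-cycle by attaching a pendant path with three new vertices to one vertex of the cycle (i.e., C₄ together with a pendant path of length 3). Then the class of Z-free chordal bipartite graphs is factorial: there exist constants c₁, c₂ > 0 and N such that for every n ≥ N, the number of simple graphs on the labeled vertex set {1, …, n} that are chordal bipartite and Z-free is at least n^(c₁·n) and at most n^(c₂·n). -/

import Mathlib

open SimpleGraph

/-- The graph `Z`: a 4-cycle `0-1-2-3-0` with a pendant path `0-4-5-6` of three new
vertices attached to the cycle vertex `0`. -/
def Zgraph : SimpleGraph (Fin 7) :=
  SimpleGraph.fromRel fun i j =>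
    ((i : ℕ), (j : ℕ)) ∈ [(0,1),(1,2),(2,3),(3,0),(0,4),(4,5),(5,6)]

/-- Chordal bipartite: bipartite with no induced cycle of length 6 or more. -/
def ChordalBipartite {V : Type*} (G : SimpleGraph V) : Prop :=
  G.Colorable 2 ∧ ∀ m : ℕ, 6 ≤ m → ¬ Nonempty (SimpleGraph.cycleGraph m ↪g G)


set_option linter.unusedSectionVars false

/-- The crossing lemma as a property. -/
def Crs {V : Type*} (G : SimpleGraph V) : Prop :=
  ∀ P R Q a b b' p r : V, G.Adj P p → ¬ G.Adj R p → G.Adj R r → ¬ G.Adj P r →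
    G.Adj P a → G.Adj R a → ¬ G.Adj Q a → b ≠ b' → G.Adj Q b → G.Adj Q b' →
    (G.Adj P b ∧ ¬ G.Adj R b ∨ G.Adj R b ∧ ¬ G.Adj P b) →
    (G.Adj P b' ∧ ¬ G.Adj R b' ∨ G.Adj R b' ∧ ¬ G.Adj P b') → False

lemma six_false {V : Type*} (G : SimpleGraph V) (col : V → Bool)
    (hcol : ∀ x y, G.Adj x y → col x ≠ col y)
    (h6 : ¬ Nonempty (SimpleGraph.cycleGraph 6 ↪g G))
    (P R Q a b c : V) (h1 : G.Adj P a) (h2 : G.Adj R a) (h3 : G.Adj R b) (h4 : G.Adj Q b)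
    (h5 : G.Adj Q c) (h7 : G.Adj P c) (n1 : ¬ G.Adj Q a) (n2 : ¬ G.Adj P b)
    (n3 : ¬ G.Adj R c) : False := by
  apply h6
  have e1 := hcol _ _ h1
  have e2 := hcol _ _ h2
  have e3 := hcol _ _ h3
  have e4 := hcol _ _ h4
  have e5 := hcol _ _ h5
  have bb : ∀ x y z : Bool, x ≠ z → y ≠ z → x = y := by decide
  have q1 : col P = col R := bb _ _ _ (hcol _ _ h1) (hcol _ _ h2)
  have q2 : col R = col Q := bb _ _ _ (hcol _ _ h3) (hcol _ _ h4)
  have q3 : col a = col b := bb _ _ _ (hcol _ _ h2.symm) (hcol _ _ h3.symm)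
  have q4 : col b = col c := bb _ _ _ (hcol _ _ h4.symm) (hcol _ _ h5.symm)
  have m1 : ¬ G.Adj P R := fun h => hcol _ _ h (by simp_all only)
  have m2 : ¬ G.Adj P Q := fun h => hcol _ _ h (by simp_all only)
  have m3 : ¬ G.Adj R Q := fun h => hcol _ _ h (by simp_all only)
  have m4 : ¬ G.Adj a b := fun h => hcol _ _ h (by simp_all only)
  have m5 : ¬ G.Adj a c := fun h => hcol _ _ h (by simp_all only)
  have m6 : ¬ G.Adj b c := fun h => hcol _ _ h (by simp_all only)
  have s := fun x y => G.adj_comm x y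
  let f : Fin 6 → V := ![P, a, R, b, Q, c]
  have d : ∀ i j : Fin 6, G.Adj (f i) (f j) ↔ (cycleGraph 6).Adj i j := by
    intro i j
    fin_cases i <;> fin_cases j <;> simp [f, cycleGraph_adj, h1, h2, h3, h4, h5, h7, n1, n2, n3,
      m1, m2, m3, m4, m5, m6, h1.symm, h2.symm, h3.symm, h4.symm, h5.symm, h7.symm,
      mt G.adj_symm n1, mt G.adj_symm n2, mt G.adj_symm n3, mt G.adj_symm m1, mt G.adj_symm m2,
      mt G.adj_symm m3, mt G.adj_symm m4, mt G.adj_symm m5, mt G.adj_symm m6] <;> decide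
  have inj : Function.Injective f := by
    intro i j hij
    have key : ∀ k, (cycleGraph 6).Adj i k ↔ (cycleGraph 6).Adj j k := by
      intro k; rw [← d, ← d, hij]
    revert key
    clear hij
    simp only [cycleGraph_adj]
    revert i j
    decide
  exact ⟨⟨⟨f, inj⟩, d _ _⟩⟩

set_option maxHeartbeats 1000000 in
lemma z_false {V : Type*} (G : SimpleGraph V) (col : V → Bool)
    (hcol : ∀ x y, G.Adj x y → col x ≠ col y)
    (hZ : ¬ Nonempty (Zgraph ↪g G))
    (P R Q a b c r : V) (h1 : G.Adj P b) (h2 : G.Adj P c) (h3 : G.Adj Q b) (h4 : G.Adj Q c)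
    (hbc : b ≠ c)
    (h5 : G.Adj P a) (h6 : G.Adj R a) (h7 : G.Adj R r) (n1 : ¬ G.Adj Q a) (n2 : ¬ G.Adj P r)
    (n3 : ¬ G.Adj R b) (n4 : ¬ G.Adj R c) (n5 : ¬ G.Adj Q r) : False := by
  apply hZ
  have e1 := hcol _ _ h1
  have e2 := hcol _ _ h2
  have e3 := hcol _ _ h3
  have e4 := hcol _ _ h4
  have e5 := hcol _ _ h5
  have e6 := hcol _ _ h6
  have e7 := hcol _ _ h7
  have bb : ∀ x y z : Bool, x ≠ z → y ≠ z → x = y := by decide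
  have q1 : col P = col R := bb _ _ _ (hcol _ _ h5) (hcol _ _ h6)
  have q2 : col P = col Q := bb _ _ _ (hcol _ _ h1) (hcol _ _ h3)
  have q3 : col b = col c := bb _ _ _ (hcol _ _ h1.symm) (hcol _ _ h2.symm)
  have q4 : col b = col a := bb _ _ _ (hcol _ _ h1.symm) (hcol _ _ h5.symm)
  have q5 : col a = col r := bb _ _ _ (hcol _ _ h6.symm) (hcol _ _ h7.symm)
  have ne : ∀ x y, col x ≠ col y → x ≠ y := fun x y h h' => h (by rw [h'])
  have u1 : P ≠ b := h1.ne
  have u2 : P ≠ c := h2.ne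
  have u3 : P ≠ a := h5.ne
  have u4 : P ≠ r := ne _ _ (by rw [← q5]; exact e5)
  have u5 : Q ≠ b := h3.ne
  have u6 : Q ≠ c := h4.ne
  have u7 : Q ≠ a := ne _ _ (by rw [← q2]; exact e5)
  have u8 : Q ≠ r := ne _ _ (by rw [← q2, ← q5]; exact e5)
  have u9 : R ≠ b := ne _ _ (by rw [← q1]; exact e1)
  have u10 : R ≠ c := ne _ _ (by rw [← q1]; exact e2)
  have u11 : R ≠ a := h6.ne
  have u12 : R ≠ r := h7.ne
  have m1 : ¬ G.Adj P R := fun h => hcol _ _ h (by simp_all only)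
  have m2 : ¬ G.Adj P Q := fun h => hcol _ _ h (by simp_all only)
  have m3 : ¬ G.Adj R Q := fun h => hcol _ _ h (by simp_all only)
  have m4 : ¬ G.Adj a b := fun h => hcol _ _ h (by simp_all only)
  have m5 : ¬ G.Adj a c := fun h => hcol _ _ h (by simp_all only)
  have m6 : ¬ G.Adj b c := fun h => hcol _ _ h (by simp_all only)
  have m7 : ¬ G.Adj a r := fun h => hcol _ _ h (by simp_all only)
  have m8 : ¬ G.Adj b r := fun h => hcol _ _ h (by simp_all only)
  have m9 : ¬ G.Adj c r := fun h => hcol _ _ h (by simp_all only)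
  let f : Fin 7 → V := ![P, b, Q, c, a, R, r]
  have d : ∀ i j : Fin 7, G.Adj (f i) (f j) ↔ Zgraph.Adj i j := by
    intro i j
    fin_cases i <;> fin_cases j <;> simp [f, Zgraph, h1, h2, h3, h4, h5, h6, h7, n1, n2, n3,
      n4, n5, m7, m8, m9, h6.symm,
      m1, m2, m3, m4, m5, m6, h1.symm, h2.symm, h3.symm, h4.symm, h5.symm, h7.symm,
      mt G.adj_symm n1, mt G.adj_symm n2, mt G.adj_symm n3, mt G.adj_symm m1, mt G.adj_symm m2,
      mt G.adj_symm n4, mt G.adj_symm n5, mt G.adj_symm m7, mt G.adj_symm m8, mt G.adj_symm m9,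
      mt G.adj_symm m3, mt G.adj_symm m4, mt G.adj_symm m5, mt G.adj_symm m6]
  have hPQ : P ≠ Q := fun h => n1 (h ▸ h5)
  have hPR : P ≠ R := fun h => n2 (h ▸ h7)
  have hQR : Q ≠ R := fun h => n5 (h ▸ h7)
  have hba : b ≠ a := fun h => n1 (h ▸ h3)
  have hca : c ≠ a := fun h => n1 (h ▸ h4)
  have hbr : b ≠ r := fun h => n2 (h ▸ h1)
  have hcr : c ≠ r := fun h => n2 (h ▸ h2)
  have har : a ≠ r := fun h => n2 (h ▸ h5)
  have inj : Function.Injective f := by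
    intro i j
    fin_cases i <;> fin_cases j <;> simp [f, u1, u2, u3, u4, u5, u6, u7, u8, u9, u10, u11, u12, hPQ, hPR, hQR, hba, hca, hbr, hcr, har, hbc,
      u1.symm, u2.symm, u3.symm, u4.symm, u5.symm, u6.symm, u7.symm, u8.symm, u9.symm, u10.symm, u11.symm, u12.symm, hPQ.symm, hPR.symm, hQR.symm, hba.symm, hca.symm, hbr.symm, hcr.symm, har.symm, hbc.symm]
  exact ⟨⟨⟨f, inj⟩, d _ _⟩⟩

lemma crs_of {V : Type*} (G : SimpleGraph V) (col : V → Bool)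
    (hcol : ∀ x y, G.Adj x y → col x ≠ col y)
    (h6 : ¬ Nonempty (SimpleGraph.cycleGraph 6 ↪g G))
    (hZ : ¬ Nonempty (Zgraph ↪g G)) : Crs G := by
  have S6 := six_false G col hcol h6
  have SZ := z_false G col hcol hZ
  intro P R Q a b b' p r hp np hr nr hPa hRa nQa hbb hQb hQb' hb hb'
  rcases hb with ⟨x1, x2⟩ | ⟨x1, x2⟩ <;> rcases hb' with ⟨y1, y2⟩ | ⟨y1, y2⟩
  · by_cases hq : G.Adj Q r
    · exact S6 P R Q a r b hPa hRa hr hq hQb x1 nQa nr x2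
    · exact SZ P R Q a b b' r x1 y1 hQb hQb' hbb hPa hRa hr nQa nr x2 y2 hq
  · exact S6 P R Q a b' b hPa hRa y1 hQb' hQb x1 nQa y2 x2
  · exact S6 P R Q a b b' hPa hRa x1 hQb hQb' y1 nQa x2 y2
  · by_cases hq : G.Adj Q p
    · exact S6 R P Q a p b hRa hPa hp hq hQb x1 nQa np x2
    · exact SZ R P Q a b b' p x1 y1 hQb hQb' hbb hRa hPa hp nQa np x2 y2 hq


/-- The graph with all edges meeting `F` deleted. -/
def avoidG {V : Type*} (G : SimpleGraph V) (F : Set V) : SimpleGraph V where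
  Adj a b := G.Adj a b ∧ a ∉ F ∧ b ∉ F
  symm := ⟨fun _ _ h => ⟨h.1.symm, h.2.2, h.2.1⟩⟩
  loopless := ⟨fun _ h => h.1.ne rfl⟩

lemma cyc_adj_val (l : ℕ) (i j : Fin (l + 2)) (hl : 2 ≤ l) : (cycleGraph (l + 2)).Adj i j ↔
    (i.val = j.val + 1 ∨ j.val = i.val + 1 ∨ (i.val = 0 ∧ j.val = l + 1) ∨
      (j.val = 0 ∧ i.val = l + 1)) := by
  have key : ∀ i j : Fin (l + 2), (i - j).val = 1 ↔
      (i.val = j.val + 1 ∨ (i.val = 0 ∧ j.val = l + 1)) := by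
    intro i j
    have hi := i.isLt
    have hj := j.isLt
    rcases le_or_gt j i with h | h
    · have := Fin.coe_sub_iff_le.mpr h
      have h' : j.val ≤ i.val := h
      omega
    · have := Fin.coe_sub_iff_lt.mpr h
      have h' : i.val < j.val := h
      omega
  rw [cycleGraph_adj', key, key]
  tauto

lemma path_lemma {V : Type*} (G : SimpleGraph V) (col : V → Bool)
    (hcol : ∀ x y, G.Adj x y → col x ≠ col y)
    (hcyc : ∀ m : ℕ, 6 ≤ m → ¬ Nonempty (SimpleGraph.cycleGraph m ↪g G))
    (F : Set V) (z u v : V) (hz : z ∈ F) (hu : u ∉ F) (hv : v ∉ F) (huv : u ≠ v)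
    (hzu : G.Adj z u) (hzv : G.Adj z v) (hno : ∀ a, a ∉ F → G.Adj z a → a = u ∨ a = v)
    (hr : (avoidG G F).Reachable u v) :
    ∃ q, q ∉ F ∧ G.Adj u q ∧ G.Adj v q := by
  obtain ⟨p, hp⟩ := hr.exists_walk_length_eq_dist
  have hpath := p.isPath_of_length_eq_dist hp
  have hinj := hpath.getVert_injOn
  have hA : ∀ i, i < p.length → (avoidG G F).Adj (p.getVert i) (p.getVert (i + 1)) :=
    fun i hi => p.adj_getVert_succ hi
  have hF : ∀ i, i ≤ p.length → p.getVert i ∉ F := by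
    intro i hi
    cases i with
    | zero => simpa using hu
    | succ i => exact (hA i (by omega)).2.2
  have hch : ∀ i j, i ≤ j → j ≤ p.length → G.Adj (p.getVert i) (p.getVert j) → j = i + 1 := by
    intro i j hij hj h
    have h' : (avoidG G F).Adj (p.getVert i) (p.getVert j) := ⟨h, hF i (by omega), hF j hj⟩
    have h1 := dist_le (((p.take i).append (Walk.cons h' Walk.nil)).append (p.drop j))
    simp only [Walk.length_append, Walk.take_length, Walk.drop_length, Walk.length_cons,
      Walk.length_nil] at h1
    have : i ≠ j := by rintro rfl; exact h.ne rfl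
    omega
  let c : (avoidG G F).Coloring Bool := Coloring.mk col (fun {a b} h => hcol a b h.1)
  have hev : Even p.length := by
    rw [Coloring.even_length_iff_congr c p]
    have e1 := hcol _ _ hzu
    have e2 := hcol _ _ hzv
    change col u = true ↔ col v = true
    cases h1 : col u <;> cases h2 : col v <;> cases h3 : col z <;> simp_all
  have h0 : p.length ≠ 0 := by
    intro h
    exact huv (Walk.eq_of_length_eq_zero h)
  by_cases h2 : p.length = 2
  · refine ⟨p.getVert 1, hF 1 (by omega), ?_, ?_⟩
    · have := (hA 0 (by omega)).1
      simpa using this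
    · have := (hA 1 (by omega)).1.symm
      rwa [show (1 + 1) = p.length from h2.symm, Walk.getVert_length] at this
  exfalso
  have h4 : 4 ≤ p.length := by
    obtain ⟨k, hk⟩ := hev
    omega
  apply hcyc (p.length + 2) (by omega)
  have hz' : ∀ i, i ≤ p.length → (G.Adj z (p.getVert i) ↔ i = 0 ∨ i = p.length) := by
    intro i hi
    constructor
    · intro h
      rcases hno _ (hF i hi) h with h | h
      · left
        exact hinj (by simpa using hi) (by simp) (by simpa using h)
      · right
        exact hinj (by simpa using hi) (by simp) (by simpa using h)
    · rintro (rfl | rfl)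
      · simpa using hzu
      · simpa using hzv
  let f : Fin (p.length + 2) → V := fun i => if i.val ≤ p.length then p.getVert i.val else z
  have inj : Function.Injective f := by
    intro i j h
    have hi := i.isLt
    have hj := j.isLt
    apply Fin.ext
    simp only [f] at h
    split_ifs at h with a b b
    · exact hinj (by simpa using a) (by simpa using b) h
    · exact absurd hz (h ▸ hF _ a)
    · exact absurd hz (h ▸ hF _ b)
    · omega
  refine ⟨⟨⟨f, inj⟩, ?_⟩⟩
  intro i j
  rw [cyc_adj_val _ _ _ (by omega)]
  change G.Adj (f i) (f j) ↔ _
  have hi := i.isLt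
  have hj := j.isLt
  simp only [f]
  split_ifs with a b b
  · constructor
    · intro h
      rcases le_total i.val j.val with hh | hh
      · have := hch _ _ hh b h
        omega
      · have := hch _ _ hh a h.symm
        omega
    · rintro (h | h | h | h)
      · rw [h]
        exact (hA _ (by omega)).1.symm
      · rw [h]
        exact (hA _ (by omega)).1
      · omega
      · omega
  · rw [G.adj_comm, hz' _ a]
    omega
  · rw [hz' _ b]
    omega
  · simp only [SimpleGraph.irrefl, false_iff]
    omega


/-- Standing assumptions: a counterexample to the structural theorem. -/
structure Hyp {V : Type*} (G : SimpleGraph V) : Prop where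
  col : ∃ col : V → Bool, ∀ x y, G.Adj x y → col x ≠ col y
  cyc : ∀ m : ℕ, 6 ≤ m → ¬ Nonempty (SimpleGraph.cycleGraph m ↪g G)
  crs : Crs G
  deg : ∀ x, 7 ≤ {z | G.Adj x z}.ncard
  dif : ∀ x y, x ≠ y → 7 ≤ {z | ¬ (G.Adj x z ↔ G.Adj y z)}.ncard

/-- `Q` does not dominate `S`. -/
def ND {V : Type*} (G : SimpleGraph V) (S Q : V) : Prop := ∃ t, G.Adj S t ∧ ¬ G.Adj Q t

/-- Configurations. -/
structure Cfg {V : Type*} (G : SimpleGraph V) (S : V) (X : Set V) : Prop where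
  sub : ∀ x ∈ X, G.Adj S x
  one : ∀ Q, ND G S Q → ∀ x ∈ X, ∀ y ∈ X, G.Adj Q x → G.Adj Q y → x = y
  two : ∀ Q, ND G S Q → (∀ t, G.Adj S t → t ∉ X → G.Adj Q t) → ∀ x ∈ X, ¬ G.Adj Q x
  three : 3 ≤ X.ncard

/-- Witnesses of a configuration. -/
def Wit {V : Type*} (G : SimpleGraph V) (S : V) (X : Set V) (R : V) : Prop :=
  ND G S R ∧ ∀ t, G.Adj S t → t ∉ X → G.Adj R t

/-- Neighbours of `w` not dominating `S`. -/
def AA {V : Type*} (G : SimpleGraph V) (S w : V) : Set V := {Q | G.Adj w Q ∧ ND G S Q}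

lemma Hyp.tri {V : Type*} {G : SimpleGraph V} (h : Hyp G) {x y z : V} (h1 : G.Adj x y)
    (h2 : G.Adj x z) : ¬ G.Adj y z := by
  obtain ⟨col, hcol⟩ := h.col
  intro h3
  have e1 := hcol _ _ h1
  have e2 := hcol _ _ h2
  have e3 := hcol _ _ h3
  revert e1 e2 e3
  generalize col x = a
  generalize col y = b
  generalize col z = c
  revert a b c
  decide

lemma nd_irrefl {V : Type*} {G : SimpleGraph V} {S : V} : ¬ ND G S S := fun ⟨_, h, h'⟩ => h' h

lemma dom_of {V : Type*} {G : SimpleGraph V} {S Q : V} (h : ¬ ND G S Q) {t : V}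
    (ht : G.Adj S t) : G.Adj Q t := by
  by_contra h'
  exact h ⟨t, ht, h'⟩

lemma three_of {V : Type*} {X : Set V} [Finite V] (h : 3 ≤ X.ncard) :
    ∃ a b c, a ∈ X ∧ b ∈ X ∧ c ∈ X ∧ a ≠ b ∧ a ≠ c ∧ b ≠ c := by
  obtain ⟨a, b, c, ha, hb, hc, h1, h2, h3⟩ := (Set.two_lt_ncard_iff (Set.toFinite X)).mp h
  exact ⟨a, b, c, ha, hb, hc, h1, h2, h3⟩

section
variable {V : Type*} [Finite V] {G : SimpleGraph V}

lemma Cfg.f2 (H : Hyp G) {S : V} {X : Set V} (C : Cfg G S X) {w w' : V} (hw : w ∈ X)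
    (hw' : w' ∈ X) (hne : w ≠ w') : 7 ≤ (AA G S w).ncard + (AA G S w').ncard := by
  refine (H.dif w w' hne).trans ((Set.ncard_le_ncard ?_ (Set.toFinite _)).trans
    (Set.ncard_union_le (AA G S w) (AA G S w')))
  intro z hz
  by_cases h : G.Adj w z
  · have h' : ¬ G.Adj w' z := fun h' => hz ⟨fun _ => h', fun _ => h⟩
    exact Or.inl ⟨h, w', C.sub _ hw', fun k => h' k.symm⟩
  · have h' : G.Adj w' z := by
      by_contra h'
      exact hz ⟨fun k => absurd k h, fun k => absurd k h'⟩
    exact Or.inr ⟨h', w, C.sub _ hw, fun k => h k.symm⟩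

lemma Cfg.pick (H : Hyp G) {S : V} {X : Set V} (C : Cfg G S X) :
    ∃ w w2 w3, w ∈ X ∧ w2 ∈ X ∧ w3 ∈ X ∧ w ≠ w2 ∧ w ≠ w3 ∧ w2 ≠ w3 ∧
      4 ≤ (AA G S w).ncard ∧ 4 ≤ (AA G S w2).ncard := by
  obtain ⟨a, b, c, ha, hb, hc, h1, h2, h3⟩ := three_of C.three
  have k1 := C.f2 H ha hb h1
  have k2 := C.f2 H ha hc h2
  have k3 := C.f2 H hb hc h3
  by_cases ka : 4 ≤ (AA G S a).ncard
  · by_cases kb : 4 ≤ (AA G S b).ncard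
    · exact ⟨a, b, c, ha, hb, hc, h1, h2, h3, ka, kb⟩
    · exact ⟨a, c, b, ha, hc, hb, h2, h1, h3.symm, ka, by omega⟩
  · exact ⟨b, c, a, hb, hc, ha, h3, h1.symm, h2.symm, by omega, by omega⟩

lemma nonempty_of {X : Set V} {n : ℕ} (hn : 0 < n) (h : n ≤ X.ncard) : ∃ a, a ∈ X :=
  (Set.ncard_pos (Set.toFinite X)).mp (by omega)

lemma Cfg.f3 (H : Hyp G) {S : V} {X : Set V} (C : Cfg G S X) {w w' : V} (hw : w ∈ X)
    (hw' : w' ∈ X) (hne : w ≠ w') {A0 : V} (hA0 : A0 ∈ AA G S w') {v A B : V}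
    (hv : ¬ G.Adj S v) (hA : A ∈ AA G S w) (hB : B ∈ AA G S w) (hAv : G.Adj v A)
    (hBv : G.Adj v B) : A = B := by
  by_contra hAB
  have m1 : ∀ A, A ∈ AA G S w → ¬ G.Adj w' A := fun A hA h =>
    hne (C.one A hA.2 w hw w' hw' hA.1.symm h.symm)
  have m2 : ¬ G.Adj w A0 := fun h =>
    hne (C.one A0 hA0.2 w hw w' hw' h.symm hA0.1.symm)
  exact H.crs w w' v S A B A A0 hA.1 (m1 A hA) hA0.1 m2 (C.sub _ hw).symm (C.sub _ hw').symm
    (fun h => hv h.symm) hAB hAv hBv (Or.inl ⟨hA.1, m1 A hA⟩) (Or.inl ⟨hB.1, m1 B hB⟩)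

lemma Cfg.iistar (H : Hyp G) {S : V} {X : Set V} (C : Cfg G S X) {R1 R2 : V} (hR : R1 ≠ R2)
    (hR1 : Wit G S X R1) (hR2 : Wit G S X R2) {w : V} (hw : w ∈ X) {v A : V}
    (hSv : G.Adj S v) (hv : ND G w v) (hA : A ∈ AA G S w) : ¬ G.Adj v A := by
  intro hvA
  by_cases hvX : v ∈ X
  · have := C.one A hA.2 w hw v hvX hA.1.symm hvA.symm
    subst this
    exact nd_irrefl hv
  · obtain ⟨c, hc1, hc2⟩ := hv
    have n1 : ¬ G.Adj w R1 := fun h => C.two R1 hR1.1 hR1.2 w hw h.symm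
    have n2 : ¬ G.Adj w R2 := fun h => C.two R2 hR2.1 hR2.2 w hw h.symm
    have a1 := (hR1.2 v hSv hvX).symm
    have a2 := (hR2.2 v hSv hvX).symm
    refine C.two A hA.2 ?_ w hw hA.1.symm
    intro v' hSv' hv'
    by_contra hn
    exact H.crs w v v' A R1 R2 c R1 hc1 hc2 a1 n1 hA.1 hvA (fun h => hn h.symm) hR
      (hR1.2 v' hSv' hv').symm (hR2.2 v' hSv' hv').symm (Or.inr ⟨a1, n1⟩) (Or.inr ⟨a2, n2⟩)

/-- The forbidden set for the measure. -/
def FF (G : SimpleGraph V) (S : V) (X : Set V) : Set V :=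
  {t | ¬ ND G S t ∨ (G.Adj S t ∧ t ∉ X)}

/-- The measure set. -/
def KK (G : SimpleGraph V) (S : V) (X : Set V) : Set V :=
  {q | ∃ y ∈ X, (avoidG G (FF G S X)).Reachable y q}

lemma Cfg.step (H : Hyp G) {S : V} {X : Set V} (C : Cfg G S X) {R1 R2 : V} (hR : R1 ≠ R2)
    (hR1 : Wit G S X R1) (hR2 : Wit G S X R2) :
    ∃ S' X' R1' R2', Cfg G S' X' ∧ R1' ≠ R2' ∧ Wit G S' X' R1' ∧ Wit G S' X' R2' ∧
      KK G S' X' ⊂ KK G S X := by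
  obtain ⟨w, w2, w3, hw, hw2, hw3, hn2, hn3, hn23, c1, c2⟩ := C.pick H
  have star := fun {v A : V} => C.iistar H hR hR1 hR2 hw (v := v) (A := A)
  obtain ⟨A1, hA1⟩ := nonempty_of (by norm_num) c1
  obtain ⟨A2, hA2⟩ := nonempty_of (by norm_num) c2
  have hSw := C.sub _ hw
  have wit : ∀ w', w' ∈ X → w ≠ w' → Wit G w (AA G S w) w' := by
    intro w' hw' hne
    refine ⟨⟨A1, hA1.1, fun h => hne (C.one A1 hA1.2 w hw w' hw' hA1.1.symm h.symm)⟩, ?_⟩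
    intro t ht1 ht2
    exact (dom_of (fun h => ht2 ⟨ht1, h⟩) (C.sub _ hw')).symm
  have hSA : S ∉ AA G S w := fun h => nd_irrefl h.2
  refine ⟨w, AA G S w, w2, w3, ⟨fun x hx => hx.1, ?_, ?_, by omega⟩, hn23, wit _ hw2 hn2,
    wit _ hw3 hn3, ?_⟩
  · intro v hv A hA B hB hvA hvB
    by_cases hSv : G.Adj S v
    · exact absurd hvA (star hSv hv hA)
    · exact C.f3 H hw hw2 hn2 hA2 hSv hA hB hvA hvB
  · intro v hv hdom A hA
    exact star (hdom S hSw.symm hSA).symm hv hA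
  · obtain ⟨col, hcol⟩ := H.col
    set F0 : Set V := {t | ¬ ND G S t ∨ (G.Adj S t ∧ t ≠ w)} with hF0
    have wF0 : w ∉ F0 := by
      rintro (h | h)
      · exact h ⟨w, hSw, G.irrefl⟩
      · exact h.2 rfl
    have inv : ∀ A ∈ AA G S w, ∀ q, (avoidG G (FF G w (AA G S w))).Reachable A q →
        q ∉ F0 ∧ q ∉ FF G w (AA G S w) ∧ (avoidG G F0).Reachable w q := by
      intro A hA q hq
      rw [SimpleGraph.reachable_iff_reflTransGen] at hq
      induction hq with
      | refl =>
        have hnA : ¬ G.Adj S A := H.tri hSw.symm hA.1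
        have hAF : A ∉ F0 := by
          rintro (h | h)
          · exact h hA.2
          · exact hnA h.1
        refine ⟨hAF, ?_, Adj.reachable ⟨hA.1, wF0, hAF⟩⟩
        rintro (h | h)
        · exact h ⟨S, hSw.symm, fun k => hnA k.symm⟩
        · exact h.2 hA
      | @tail q q' _ hadj ih =>
        obtain ⟨i1, i2, i3⟩ := ih
        have hq'F := hadj.2.2
        have hndS : ND G S q' := by
          by_contra hh
          exact hq'F (Or.inr ⟨(dom_of hh hSw).symm, fun k => hh k.2⟩)
        have hndw : ND G w q' := by
          by_contra hh
          exact hq'F (Or.inl hh)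
        have hq'0 : q' ∉ F0 := by
          rintro (h | ⟨h, hne⟩)
          · exact h hndS
          · set F1 : Set V := {t | ¬ ND G S t ∨ (G.Adj S t ∧ t ≠ w ∧ t ≠ q')} with hF1
            have sub : F1 ⊆ F0 := by
              rintro t (ht | ht)
              · exact Or.inl ht
              · exact Or.inr ⟨ht.1, ht.2.1⟩
            have le : avoidG G F0 ≤ avoidG G F1 := by
              intro a b hab
              exact ⟨hab.1, fun k => hab.2.1 (sub k), fun k => hab.2.2 (sub k)⟩
            have q'1 : q' ∉ F1 := by
              rintro (k | k)
              · exact k hndS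
              · exact k.2.2 rfl
            have r1 : (avoidG G F1).Reachable w q' :=
              (i3.mono le).trans (Adj.reachable ⟨hadj.1, fun k => i1 (sub k), q'1⟩)
            obtain ⟨Q, hQ1, hQ2, hQ3⟩ := path_lemma G col hcol H.cyc F1 S w q' (Or.inl nd_irrefl)
              (fun k => wF0 (sub k)) q'1 hne.symm hSw h (by
                intro a ha hSa
                by_contra hh
                push Not at hh
                exact ha (Or.inr ⟨hSa, hh⟩)) r1
            have : ND G S Q := by
              by_contra hh
              exact hQ1 (Or.inl hh)
            exact star h hndw ⟨hQ2, this⟩ hQ3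
        exact ⟨hq'0, hq'F, i3.trans (Adj.reachable ⟨hadj.1, i1, hq'0⟩)⟩
    rw [Set.ssubset_iff_of_subset]
    · refine ⟨w, ⟨w, hw, Reachable.refl _⟩, ?_⟩
      rintro ⟨A, hA, h⟩
      exact (inv A hA w h).2.1 (Or.inl nd_irrefl)
    · rintro q ⟨A, hA, h⟩
      refine ⟨w, hw, (inv A hA q h).2.2.mono ?_⟩
      have sub : FF G S X ⊆ F0 := by
        rintro t (ht | ht)
        · exact Or.inl ht
        · exact Or.inr ⟨ht.1, fun k => ht.2 (k ▸ hw)⟩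
      intro a b hab
      exact ⟨hab.1, fun k => hab.2.1 (sub k), fun k => hab.2.2 (sub k)⟩

lemma no_full (H : Hyp G) : ∀ (n : ℕ) {S : V} {X : Set V} (_ : Cfg G S X) {R1 R2 : V}
    (_ : R1 ≠ R2) (_ : Wit G S X R1) (_ : Wit G S X R2), (KK G S X).ncard = n → False := by
  intro n
  induction n using Nat.strong_induction_on with
  | _ n ih =>
    intro S X C R1 R2 hR hR1 hR2 hn
    obtain ⟨S', X', R1', R2', C', hR', h1', h2', hlt⟩ := C.step H hR hR1 hR2
    exact ih _ (hn ▸ Set.ncard_lt_ncard hlt (Set.toFinite _)) C' hR' h1' h2' rfl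

end


section
variable {V : Type*} [Finite V] {G : SimpleGraph V}

lemma Cfg.boost_same (H : Hyp G) {S : V} {X : Set V} (C : Cfg G S X) {w w' w'' A0 A A' : V}
    (hw : w ∈ X) (hw' : w' ∈ X) (hw'' : w'' ∈ X) (n1 : w ≠ w') (n2 : w ≠ w'') (n3 : w' ≠ w'')
    (hA0 : A0 ∈ AA G S w') (hA : A ∈ AA G S w) (hA' : A' ∈ AA G S w)
    (htr : ∀ t, G.Adj S t → (G.Adj A t ↔ G.Adj A' t))
    (hc : 3 ≤ {t | G.Adj A t ∧ ¬ G.Adj A' t}.ncard) : False := by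
  set Y : Set V := {y | G.Adj A y ∧ ¬ G.Adj S y} with hY
  have hsub : {t | G.Adj A t ∧ ¬ G.Adj A' t} ⊆ Y := by
    rintro t ⟨h1, h2⟩
    exact ⟨h1, fun h => h2 ((htr t h).mp h1)⟩
  have hm : ∀ x, x ∈ X → w ≠ x → ¬ G.Adj A x := fun x hx hne h =>
    hne (C.one A hA.2 w hw x hx hA.1.symm h)
  obtain ⟨t0, ht0, ht0'⟩ := nonempty_of (by norm_num) hc
  have hwY : w ∉ Y := fun h => h.2 (C.sub _ hw)
  have two : ∀ Q, ND G A Q → (∀ t, G.Adj A t → t ∉ Y → G.Adj Q t) → ∀ y ∈ Y, ¬ G.Adj Q y := by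
    intro Q hQ hdom y hy hQy
    have hQw := hdom w hA.1.symm hwY
    by_cases hS : ND G S Q
    · have := C.f3 H hw hw' n1 hA0 hy.2 hA ⟨hQw.symm, hS⟩ hy.1.symm hQy.symm
      subst this
      exact nd_irrefl hQ
    · obtain ⟨t, ht1, ht2⟩ := hQ
      have q1 := dom_of hS (C.sub _ hw')
      have q2 := dom_of hS (C.sub _ hw'')
      exact H.crs A Q S y w' w'' t w' ht1 ht2 q1 (hm _ hw' n1) hy.1 hQy hy.2 n3 (C.sub _ hw')
        (C.sub _ hw'') (Or.inr ⟨q1, hm _ hw' n1⟩) (Or.inr ⟨q2, hm _ hw'' n2⟩)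
  have cfg : Cfg G A Y := by
    refine ⟨fun x hx => hx.1, ?_, two, hc.trans (Set.ncard_le_ncard hsub (Set.toFinite _))⟩
    intro Q hQ y hy y' hy' h1 h2
    by_contra hne
    refine two Q hQ ?_ y hy h1
    intro t ht htY
    have hSt : G.Adj S t := by
      by_contra hh
      exact htY ⟨ht, hh⟩
    by_contra hn
    exact H.crs A S Q t y y' y w' hy.1 hy.2 (C.sub _ hw') (hm _ hw' n1) ht hSt hn hne h1 h2
      (Or.inl hy) (Or.inl hy')
  refine no_full H _ cfg (R1 := S) (R2 := A') ?_ ?_ ?_ rfl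
  · rintro rfl
    exact nd_irrefl hA'.2
  · refine ⟨⟨t0, ht0, (hsub ⟨ht0, ht0'⟩).2⟩, ?_⟩
    intro t ht htY
    by_contra hh
    exact htY ⟨ht, hh⟩
  · refine ⟨⟨t0, ht0, ht0'⟩, ?_⟩
    intro t ht htY
    by_contra hh
    exact htY ⟨ht, fun k => hh ((htr t k).mp ht)⟩

lemma Cfg.traces (H : Hyp G) {S : V} {X : Set V} (C : Cfg G S X) {w w' w'' A0 A A' : V}
    (hw : w ∈ X) (hw' : w' ∈ X) (hw'' : w'' ∈ X) (n1 : w ≠ w') (n2 : w ≠ w'') (n3 : w' ≠ w'')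
    (hA0 : A0 ∈ AA G S w') (hA : A ∈ AA G S w) (hA' : A' ∈ AA G S w) (hne : A ≠ A')
    (htr : ∀ t, G.Adj S t → (G.Adj A t ↔ G.Adj A' t)) : False := by
  have hd := H.dif A A' hne
  have hle : {z | ¬ (G.Adj A z ↔ G.Adj A' z)}.ncard ≤ {t | G.Adj A t ∧ ¬ G.Adj A' t}.ncard +
      {t | G.Adj A' t ∧ ¬ G.Adj A t}.ncard := by
    refine (Set.ncard_le_ncard ?_ (Set.toFinite _)).trans (Set.ncard_union_le _ _)
    intro z hz
    simp only [Set.mem_ofPred_eq, Set.mem_union] at hz ⊢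
    tauto
  by_cases h : 3 ≤ {t | G.Adj A t ∧ ¬ G.Adj A' t}.ncard
  · exact C.boost_same H hw hw' hw'' n1 n2 n3 hA0 hA hA' htr h
  · exact C.boost_same H hw hw' hw'' n1 n2 n3 hA0 hA' hA (fun t ht => (htr t ht).symm) (by omega)

lemma Cfg.comp (H : Hyp G) {S : V} {X : Set V} (C : Cfg G S X) {R : V} (hR : Wit G S X R)
    {w A B v v' : V} (hw : w ∈ X) (hA : A ∈ AA G S w) (hB : B ∈ AA G S w)
    (h1 : G.Adj S v) (h2 : G.Adj A v) (h3 : ¬ G.Adj B v)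
    (h4 : G.Adj S v') (h5 : G.Adj B v') (h6 : ¬ G.Adj A v') : False := by
  have e1 : v ∉ X := fun h => by
    have := C.one A hA.2 w hw v h hA.1.symm h2
    exact h3 (this ▸ hB.1.symm)
  have e2 : v' ∉ X := fun h => by
    have := C.one B hB.2 w hw v' h hB.1.symm h5
    exact h6 (this ▸ hA.1.symm)
  have hwR : ¬ G.Adj w R := fun h => C.two R hR.1 hR.2 w hw h.symm
  have hvR := (hR.2 v h1 e1).symm
  exact H.crs w v v' A B R B R hB.1 (fun h => h3 h.symm) hvR hwR hA.1 h2.symm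
    (fun h => h6 h.symm) (fun h => hwR (h ▸ hB.1)) h5.symm (hR.2 v' h4 e2).symm
    (Or.inl ⟨hB.1, fun h => h3 h.symm⟩) (Or.inr ⟨hvR, hwR⟩)

/-- A chain of four rows through `w`. -/
structure Chn (G : SimpleGraph V) (S : V) (X : Set V) (w A1 A2 A3 A4 v2 v3 : V) : Prop where
  m1 : A1 ∈ AA G S w
  m2 : A2 ∈ AA G S w
  m3 : A3 ∈ AA G S w
  m4 : A4 ∈ AA G S w
  s2 : G.Adj S v2
  s3 : G.Adj S v3
  x2 : v2 ∉ X
  x3 : v3 ∉ X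
  ne : A1 ≠ A2
  a12 : G.Adj A1 v2
  a13 : G.Adj A1 v3
  a22 : G.Adj A2 v2
  a23 : G.Adj A2 v3
  a33 : G.Adj A3 v3
  n32 : ¬ G.Adj A3 v2
  n43 : ¬ G.Adj A4 v3

lemma Cfg.chain (H : Hyp G) {S : V} {X : Set V} (C : Cfg G S X) {R : V} (hR : Wit G S X R)
    {w w' w'' A0 : V}
    (hw : w ∈ X) (hw' : w' ∈ X) (hw'' : w'' ∈ X) (n1 : w ≠ w') (n2 : w ≠ w'') (n3 : w' ≠ w'')
    (hA0 : A0 ∈ AA G S w') (hc : 4 ≤ (AA G S w).ncard) :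
    ∃ A1 A2 A3 A4 v2 v3, Chn G S X w A1 A2 A3 A4 v2 v3 := by
  have hmin : ∀ Y : Set V, Y ⊆ AA G S w → 0 < Y.ncard → ∃ A ∈ Y, ∀ B ∈ Y, B ≠ A →
      (∀ t, G.Adj S t → G.Adj A t → G.Adj B t) ∧ ∃ t, G.Adj S t ∧ G.Adj B t ∧ ¬ G.Adj A t := by
    intro Y hY hpos
    obtain ⟨A, hAY, hA⟩ := Set.exists_min_image Y (fun Q => {t | G.Adj S t ∧ G.Adj Q t}.ncard)
      (Set.toFinite _) ((Set.ncard_pos (Set.toFinite _)).mp hpos)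
    refine ⟨A, hAY, fun B hB hne => ?_⟩
    have hex : ∃ t, G.Adj S t ∧ G.Adj B t ∧ ¬ G.Adj A t := by
      by_contra hcon
      push Not at hcon
      refine C.traces H hw hw' hw'' n1 n2 n3 hA0 (hY hB) (hY hAY) hne ?_
      intro t ht
      refine ⟨hcon t ht, fun hAt => ?_⟩
      by_contra hBt
      have := Set.ncard_lt_ncard (s := {t | G.Adj S t ∧ G.Adj B t})
        (t := {t | G.Adj S t ∧ G.Adj A t}) (by
          rw [Set.ssubset_iff_of_subset]
          · exact ⟨t, ⟨ht, hAt⟩, fun k => hBt k.2⟩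
          · intro s hs
            exact ⟨hs.1, hcon s hs.1 hs.2⟩) (Set.toFinite _)
      have h2 := hA B hB
      omega
    refine ⟨fun t ht hAt => ?_, hex⟩
    by_contra hBt
    obtain ⟨s, hs1, hs2, hs3⟩ := hex
    exact C.comp H hR hw (hY hAY) (hY hB) ht hAt hBt hs1 hs2 hs3
  have hd : ∀ (Y : Set V) (A : V), Y.ncard ≤ (Y \ {A}).ncard + 1 := by
    intro Y A
    have := Set.pred_ncard_le_ncard_sdiff_singleton Y A
    omega
  obtain ⟨A4, h4, k4⟩ := hmin _ subset_rfl (by omega)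
  have d4 := hd (AA G S w) A4
  obtain ⟨A3, h3, k3⟩ := hmin (AA G S w \ {A4}) Set.sdiff_subset (by omega)
  have d3 := hd (AA G S w \ {A4}) A3
  obtain ⟨A2, h2, k2⟩ := hmin ((AA G S w \ {A4}) \ {A3})
    (Set.sdiff_subset.trans Set.sdiff_subset) (by omega)
  have d2 := hd ((AA G S w \ {A4}) \ {A3}) A2
  obtain ⟨A1, h1⟩ := nonempty_of (X := ((AA G S w \ {A4}) \ {A3}) \ {A2}) (n := 1)
    (by norm_num) (by omega)
  obtain ⟨-, v3, s3, a33, n43⟩ := k4 A3 h3.1 h3.2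
  obtain ⟨l32, v2, s2, a22, n32⟩ := k3 A2 h2.1 h2.2
  obtain ⟨l21, -⟩ := k2 A1 h1.1 h1.2
  have a23 := l32 v3 s3 a33
  have hX : ∀ v B D, B ∈ AA G S w → D ∈ AA G S w → G.Adj B v → ¬ G.Adj D v → v ∉ X := by
    intro v B D hB hD h1 h2 hv
    have := C.one B hB.2 w hw v hv hB.1.symm h1
    exact h2 (this ▸ hD.1.symm)
  exact ⟨A1, A2, A3, A4, v2, v3, h1.1.1.1, h2.1.1, h3.1, h4, s2, s3,
    hX v2 A2 A3 h2.1.1 h3.1 a22 n32, hX v3 A3 A4 h3.1 h4 a33 n43, h1.2,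
    l21 v2 s2 a22, l21 v3 s3 a23, a22, a23, a33, n32, n43⟩

lemma Cfg.chn_f2 (H : Hyp G) {S : V} {X : Set V} (C : Cfg G S X) {R : V} (hR : Wit G S X R)
    {w w' : V} (hw : w ∈ X) (hw' : w' ∈ X) (hne : w ≠ w')
    {A1 A2 A3 A4 v2 v3 B1 B2 B3 B4 u2 u3 : V} (c : Chn G S X w A1 A2 A3 A4 v2 v3)
    (d : Chn G S X w' B1 B2 B3 B4 u2 u3) : G.Adj A1 u2 ∨ G.Adj A1 u3 := by
  have hwR : ¬ G.Adj w R := fun h => C.two R hR.1 hR.2 w hw h.symm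
  have hwR' : ¬ G.Adj w' R := fun h => C.two R hR.1 hR.2 w' hw' h.symm
  have hwB : ¬ G.Adj w B1 := fun h => hne (C.one B1 d.m1.2 w hw w' hw' h.symm d.m1.1.symm)
  have r2 := (hR.2 _ c.s2 c.x2).symm
  have r3 := (hR.2 _ c.s3 c.x3).symm
  have f1 : ¬ (G.Adj B1 v2 ∧ G.Adj B1 v3) := by
    rintro ⟨h2, h3⟩
    exact H.crs w v3 v2 A3 B1 R A4 R c.m4.1 (fun h => c.n43 h.symm) r3 hwR c.m3.1 c.a33.symm
      (fun h => c.n32 h.symm) (fun h => hwR' (h ▸ d.m1.1)) h2.symm r2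
      (Or.inr ⟨h3.symm, hwB⟩) (Or.inr ⟨r3, hwR⟩)
  obtain ⟨m, hm1, hm2, hm3⟩ : ∃ m, G.Adj A1 m ∧ ¬ G.Adj B1 m ∧ G.Adj R m := by
    by_cases h2 : G.Adj B1 v2
    · exact ⟨v3, c.a13, fun h => f1 ⟨h2, h⟩, r3.symm⟩
    · exact ⟨v2, c.a12, h2, r2.symm⟩
  by_contra hcon
  push Not at hcon
  obtain ⟨i, hi1, hi2, hi3⟩ : ∃ i, G.Adj S i ∧ i ∉ X ∧ ¬ G.Adj A1 i := by
    by_contra hh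
    push Not at hh
    exact C.two A1 c.m1.2 hh w hw c.m1.1.symm
  have hu : u2 ≠ u3 := by
    rintro rfl
    exact d.n32 d.a33
  exact H.crs R A1 B1 m u2 u3 i w (hR.2 i hi1 hi2) hi3 c.m1.1.symm (fun h => hwR h.symm) hm3 hm1
    hm2 hu d.a12 d.a13 (Or.inl ⟨hR.2 _ d.s2 d.x2, hcon.1⟩) (Or.inl ⟨hR.2 _ d.s3 d.x3, hcon.2⟩)

lemma no_weak (H : Hyp G) {S : V} {X : Set V} (C : Cfg G S X) {R : V} (hR : Wit G S X R) :
    False := by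
  obtain ⟨w, w', w3, hw, hw', hw3, hn2, hn3, hn23, c1, c2⟩ := C.pick H
  obtain ⟨P1, hP1⟩ := nonempty_of (by norm_num) c1
  obtain ⟨P2, hP2⟩ := nonempty_of (by norm_num) c2
  obtain ⟨A1, A2, A3, A4, v2, v3, c⟩ := C.chain H hR hw hw' hw3 hn2 hn3 hn23 hP2 c1
  obtain ⟨B1, B2, B3, B4, u2, u3, d⟩ := C.chain H hR hw' hw hw3 hn2.symm hn23 hn3 hP1 c2
  have hwR : ¬ G.Adj w R := fun h => C.two R hR.1 hR.2 w hw h.symm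
  have hwR' : ¬ G.Adj w' R := fun h => C.two R hR.1 hR.2 w' hw' h.symm
  obtain ⟨v, B, hB, hBv, h1v, h2v, hRv, hB1v⟩ : ∃ v B, B ∈ AA G S w ∧ ¬ G.Adj B v ∧ G.Adj A1 v ∧
      G.Adj A2 v ∧ G.Adj R v ∧ G.Adj B1 v := by
    rcases C.chn_f2 H hR hw' hw hn2.symm d c with h | h
    · exact ⟨v2, A3, c.m3, c.n32, c.a12, c.a22, hR.2 _ c.s2 c.x2, h⟩
    · exact ⟨v3, A4, c.m4, c.n43, c.a13, c.a23, hR.2 _ c.s3 c.x3, h⟩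
  obtain ⟨u, D, hD, hDu, h1u, hRu, hA1u⟩ : ∃ u D, D ∈ AA G S w' ∧ ¬ G.Adj D u ∧ G.Adj B1 u ∧
      G.Adj R u ∧ G.Adj A1 u := by
    rcases C.chn_f2 H hR hw hw' hn2 c d with h | h
    · exact ⟨u2, B3, d.m3, d.n32, d.a12, hR.2 _ d.s2 d.x2, h⟩
    · exact ⟨u3, B4, d.m4, d.n43, d.a13, hR.2 _ d.s3 d.x3, h⟩
  have hwB : ¬ G.Adj w B1 := fun h => hn2 (C.one B1 d.m1.2 w hw w' hw' h.symm d.m1.1.symm)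
  have hwA : ∀ A, A ∈ AA G S w → ¬ G.Adj w' A := fun A hA h =>
    hn2 (C.one A hA.2 w hw w' hw' hA.1.symm h.symm)
  have f3 : ¬ G.Adj A2 u := fun h =>
    H.crs w' u w B1 A1 A2 D R hD.1 (fun k => hDu k.symm) hRu.symm hwR' d.m1.1 h1u.symm hwB c.ne
      c.m1.1 c.m2.1 (Or.inr ⟨hA1u.symm, hwA _ c.m1⟩) (Or.inr ⟨h.symm, hwA _ c.m2⟩)
  exact H.crs w v u A2 B1 R B R hB.1 (fun k => hBv k.symm) hRv.symm hwR c.m2.1 h2v.symm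
    (fun k => f3 k.symm) (fun h => hwR' (h ▸ d.m1.1)) h1u.symm hRu.symm
    (Or.inr ⟨hB1v.symm, hwB⟩) (Or.inr ⟨hRv.symm, hwR⟩)

end


section
variable {V : Type*} [Finite V] {G : SimpleGraph V}

/-- Two vertices with a common neighbour and incomparable neighbourhoods. -/
def Crossing (G : SimpleGraph V) (P R : V) : Prop :=
  (∃ a, G.Adj P a ∧ G.Adj R a) ∧ ND G P R ∧ ND G R P

lemma sub_ncard {Q z : V} (h : ¬ ND G z Q) (hn : ND G Q z) :
    {t | G.Adj z t}.ncard < {t | G.Adj Q t}.ncard := by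
  apply Set.ncard_lt_ncard _ (Set.toFinite _)
  rw [Set.ssubset_iff_of_subset]
  · exact hn
  · intro t ht
    exact dom_of h ht

lemma exists_crossing [Nonempty V] (H : Hyp G) : ∃ P R, Crossing G P R := by
  by_contra hcon
  push Not at hcon
  obtain ⟨Q, hQ⟩ := Finite.exists_min (fun Q : V => {t | G.Adj Q t}.ncard)
  obtain ⟨u, u', -, hu, hu', -, hne, -, -⟩ := three_of (le_trans (by norm_num) (H.deg Q))
  have key : ∀ u u', G.Adj Q u → G.Adj Q u' → ∀ z, G.Adj u z → G.Adj u' z := by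
    intro u u' hu hu' z hz
    by_contra hh
    have h1 : ND G Q z := ⟨u', hu', fun k => hh k.symm⟩
    by_cases h2 : ND G z Q
    · exact hcon Q z ⟨⟨u, hu, hz.symm⟩, h1, h2⟩
    · have h3 := sub_ncard h2 h1
      have h4 := hQ z
      omega
  have hd := H.dif u u' hne
  have : {z | ¬ (G.Adj u z ↔ G.Adj u' z)} = ∅ := by
    apply Set.eq_empty_of_forall_notMem
    intro z hz
    exact hz ⟨key u u' hu hu' z, key u' u hu' hu z⟩
  rw [this] at hd
  simp at hd

lemma base_half (H : Hyp G) {P R : V} (hc : Crossing G P R)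
    (hmax : ∀ P' R', Crossing G P' R' → {t | G.Adj P' t ∧ G.Adj R' t}.ncard ≤
      {t | G.Adj P t ∧ G.Adj R t}.ncard) :
    ∃ Q, (∀ t, G.Adj Q t → G.Adj P t) ∧ (∀ t, G.Adj P t → G.Adj R t → G.Adj Q t) ∧ ND G Q R ∧
      ¬ 3 ≤ {t | G.Adj Q t ∧ ¬ G.Adj R t}.ncard := by
  obtain ⟨Q, ⟨hQ1, hQ2, hQ3⟩, hmin⟩ := Set.exists_min_image
    {Q | (∀ t, G.Adj Q t → G.Adj P t) ∧ (∀ t, G.Adj P t → G.Adj R t → G.Adj Q t) ∧ ND G Q R}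
    (fun Q => {t | G.Adj Q t}.ncard) (Set.toFinite _) ⟨P, fun t h => h, fun t h _ => h, hc.2.1⟩
  refine ⟨Q, hQ1, hQ2, hQ3, fun h3 => ?_⟩
  obtain ⟨⟨a, haP, haR⟩, -, r, hr1, hr2⟩ := hc
  set X : Set V := {t | G.Adj Q t ∧ ¬ G.Adj R t} with hX
  have two : ∀ T, ND G Q T → (∀ t, G.Adj Q t → t ∉ X → G.Adj T t) → ∀ x ∈ X, ¬ G.Adj T x := by
    intro T hT hdom x hx hTx
    have hI : ∀ t, G.Adj P t → G.Adj R t → G.Adj T t := fun t h1 h2 =>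
      hdom t (hQ2 t h1 h2) (fun k => k.2 h2)
    by_cases h : ND G T Q
    · have hm := hmax Q T ⟨⟨a, hQ2 a haP haR, hI a haP haR⟩, hT, h⟩
      have : {t | G.Adj P t ∧ G.Adj R t}.ncard < {t | G.Adj Q t ∧ G.Adj T t}.ncard := by
        apply Set.ncard_lt_ncard _ (Set.toFinite _)
        rw [Set.ssubset_iff_of_subset]
        · exact ⟨x, ⟨hx.1, hTx⟩, fun k => hx.2 k.2⟩
        · intro t ht
          exact ⟨hQ2 t ht.1 ht.2, hI t ht.1 ht.2⟩
      omega
    · have h1 := hmin T ⟨fun t ht => hQ1 t (dom_of h ht), hI, ⟨x, hTx, hx.2⟩⟩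
      have h2 := sub_ncard h hT
      omega
  refine no_weak H (S := Q) (X := X) (R := R) ⟨fun x hx => hx.1, ?_, two, h3⟩ ⟨hQ3, ?_⟩
  · intro T hT x hx y hy h1 h2
    by_contra hne
    refine two T hT ?_ x hx h1
    intro t ht htX
    have hRt : G.Adj R t := by
      by_contra hh
      exact htX ⟨ht, hh⟩
    by_contra hn
    exact H.crs Q R T t x y x r hx.1 hx.2 hr1 (fun k => hr2 (hQ1 r k)) ht hRt hn hne h1 h2
      (Or.inl hx) (Or.inl hy)
  · intro t ht htX
    by_contra hh
    exact htX ⟨ht, hh⟩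

lemma no_hyp [Nonempty V] (H : Hyp G) : False := by
  obtain ⟨P0, R0, h0⟩ := exists_crossing H
  obtain ⟨⟨P, R⟩, hPR, hmax⟩ := Set.exists_max_image {p : V × V | Crossing G p.1 p.2}
    (fun p => {t | G.Adj p.1 t ∧ G.Adj p.2 t}.ncard) (Set.toFinite _) ⟨(P0, R0), h0⟩
  have hm : ∀ P' R', Crossing G P' R' → {t | G.Adj P' t ∧ G.Adj R' t}.ncard ≤
      {t | G.Adj P t ∧ G.Adj R t}.ncard := fun P' R' h => hmax (P', R') h
  have hcomm : {t | G.Adj P t ∧ G.Adj R t} = {t | G.Adj R t ∧ G.Adj P t} := by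
    ext t
    exact and_comm
  have hc : Crossing G P R := hPR
  have hc' : Crossing G R P := ⟨hc.1.imp fun a h => h.symm, hc.2.2, hc.2.1⟩
  obtain ⟨Q0, a1, a2, ⟨x, hx1, hx2⟩, a4⟩ := base_half H hc hm
  obtain ⟨Q1, b1, b2, b3, b4⟩ := base_half H hc' (by rw [← hcomm]; exact hm)
  have hne : Q0 ≠ Q1 := by
    rintro rfl
    exact hx2 (b1 x hx1)
  have hd := H.dif Q0 Q1 hne
  have hle : {z | ¬ (G.Adj Q0 z ↔ G.Adj Q1 z)}.ncard ≤ {t | G.Adj Q0 t ∧ ¬ G.Adj R t}.ncard +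
      {t | G.Adj Q1 t ∧ ¬ G.Adj P t}.ncard := by
    refine (Set.ncard_le_ncard ?_ (Set.toFinite _)).trans (Set.ncard_union_le _ _)
    intro z hz
    by_cases h : G.Adj Q0 z
    · refine Or.inl ⟨h, fun k => hz ⟨fun _ => b2 z k (a1 z h), fun _ => h⟩⟩
    · have h' : G.Adj Q1 z := by
        by_contra h'
        exact hz ⟨fun k => absurd k h, fun k => absurd k h'⟩
      exact Or.inr ⟨h', fun k => h (a2 z k (b1 z h'))⟩
  omega

end

/-- The structural theorem. -/
lemma structural {V : Type*} [Finite V] [Nonempty V] (G : SimpleGraph V)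
    (hc : G.Colorable 2) (hcyc : ∀ m : ℕ, 6 ≤ m → ¬ Nonempty (SimpleGraph.cycleGraph m ↪g G))
    (hZ : ¬ Nonempty (Zgraph ↪g G)) :
    (∃ x, {z | G.Adj x z}.ncard ≤ 6) ∨
      ∃ x y, x ≠ y ∧ {z | ¬ (G.Adj x z ↔ G.Adj y z)}.ncard ≤ 6 := by
  by_contra hcon
  have h1 : ∀ x, ¬ {z | G.Adj x z}.ncard ≤ 6 := fun x h => hcon (Or.inl ⟨x, h⟩)
  have h2 : ∀ x y, x ≠ y → ¬ {z | ¬ (G.Adj x z ↔ G.Adj y z)}.ncard ≤ 6 :=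
    fun x y h h' => hcon (Or.inr ⟨x, y, h, h'⟩)
  obtain ⟨c⟩ := hc
  have hcol : ∀ x y, G.Adj x y → decide (c x = 0) ≠ decide (c y = 0) := by
    intro x y h
    have h3 := c.valid h
    revert h3
    generalize c x = a
    generalize c y = b
    revert a b
    decide
  refine no_hyp (G := G) ⟨⟨_, hcol⟩, hcyc, crs_of G _ hcol (hcyc 6 le_rfl) hZ, ?_, ?_⟩
  · intro x
    have := h1 x
    omega
  · intro x y h
    have := h2 x y h
    omega


/-- The class of graphs being counted. -/
abbrev Cls (n : ℕ) : Type := {G : SimpleGraph (Fin n) //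
  ChordalBipartite G ∧ ¬ Nonempty (Zgraph ↪g G)}

lemma list_code {V : Type*} [Finite V] (D : Set V) (h : D.ncard ≤ 6) :
    ∃ g : Fin 6 → Option V, ∀ z, z ∈ D ↔ ∃ i, g i = some z := by
  let s := D.toFinite.toFinset
  have hs : s.toList.length ≤ 6 := by
    rw [Finset.length_toList, ← Set.ncard_eq_toFinset_card D]
    exact h
  refine ⟨fun i => s.toList[i.val]?, fun z => ?_⟩
  have : z ∈ D ↔ z ∈ s.toList := by simp [s]
  rw [this, List.mem_iff_getElem?]
  constructor
  · rintro ⟨i, hi⟩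
    have : i < s.toList.length := by
      by_contra hh
      rw [List.getElem?_eq_none (by omega)] at hi
      simp at hi
    exact ⟨⟨i, by omega⟩, hi⟩
  · rintro ⟨i, hi⟩
    exact ⟨i.val, hi⟩

/-- The code of a graph. -/
def CodeProp {n : ℕ} (G : SimpleGraph (Fin (n + 1))) (x : Fin (n + 1)) (y : Option (Fin (n + 1)))
    (g : Fin 6 → Option (Fin (n + 1))) : Prop :=
  ∀ z, z ≠ x → (G.Adj x z ↔ ¬ ((∃ y', y = some y' ∧ y' ≠ x ∧ G.Adj y' z) ↔ ∃ i, g i = some z))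

lemma exists_code {n : ℕ} (G : Cls (n + 1)) : ∃ x y g, CodeProp G.1 x y g := by
  rcases structural G.1 G.2.1.1 G.2.1.2 G.2.2 with ⟨x, h⟩ | ⟨x, y, hne, h⟩
  · obtain ⟨g, hg⟩ := list_code _ h
    refine ⟨x, none, g, fun z _ => ?_⟩
    rw [← hg z]
    simp
  · obtain ⟨g, hg⟩ := list_code _ h
    refine ⟨x, some y, g, fun z _ => ?_⟩
    rw [← hg z]
    have : (∃ y', some y = some y' ∧ y' ≠ x ∧ G.1.Adj y' z) ↔ G.1.Adj y z := by
      constructor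
      · rintro ⟨y', h1, _, h2⟩
        cases h1
        exact h2
      · intro h
        exact ⟨y, rfl, hne.symm, h⟩
    rw [this]
    simp only [Set.mem_ofPred_eq]
    tauto

/-- Deleting a vertex. -/
def delV {n : ℕ} (G : Cls (n + 1)) (x : Fin (n + 1)) : Cls n :=
  ⟨G.1.comap x.succAbove, by
    have e : G.1.comap x.succAbove ↪g G.1 :=
      SimpleGraph.Embedding.comap x.succAboveEmb G.1
    refine ⟨⟨?_, ?_⟩, ?_⟩
    · obtain ⟨c⟩ := G.2.1.1
      exact ⟨c.comp e.toHom⟩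
    · rintro m hm ⟨f⟩
      exact G.2.1.2 m hm ⟨e.comp f⟩
    · rintro ⟨f⟩
      exact G.2.2 ⟨e.comp f⟩⟩

lemma code_inj {n : ℕ} (G1 G2 : SimpleGraph (Fin (n + 1))) (x : Fin (n + 1))
    (y : Option (Fin (n + 1))) (g : Fin 6 → Option (Fin (n + 1))) (h1 : CodeProp G1 x y g)
    (h2 : CodeProp G2 x y g) (h : G1.comap x.succAbove = G2.comap x.succAbove) : G1 = G2 := by
  have k : ∀ a b, a ≠ x → b ≠ x → (G1.Adj a b ↔ G2.Adj a b) := by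
    intro a b ha hb
    obtain ⟨a', rfl⟩ := Fin.exists_succAbove_eq ha
    obtain ⟨b', rfl⟩ := Fin.exists_succAbove_eq hb
    change (G1.comap x.succAbove).Adj a' b' ↔ (G2.comap x.succAbove).Adj a' b'
    rw [h]
  have kx : ∀ z, z ≠ x → (G1.Adj x z ↔ G2.Adj x z) := by
    intro z hz
    rw [h1 z hz, h2 z hz]
    have : (∃ y', y = some y' ∧ y' ≠ x ∧ G1.Adj y' z) ↔
        (∃ y', y = some y' ∧ y' ≠ x ∧ G2.Adj y' z) := by
      refine exists_congr fun y' => and_congr_right fun _ => and_congr_right fun hy => k _ _ hy hz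
    rw [this]
  ext a b
  by_cases ha : a = x
  · subst ha
    by_cases hb : b = a
    · subst hb
      simp
    · exact kx b hb
  · by_cases hb : b = x
    · subst hb
      rw [G1.adj_comm, G2.adj_comm]
      exact kx a ha
    · exact k a b ha hb

lemma card_succ (n : ℕ) : Nat.card (Cls (n + 1)) ≤ (n + 2) ^ 8 * Nat.card (Cls n) := by
  choose cx cy cg hc using fun G : Cls (n + 1) => exists_code G
  let F : Cls (n + 1) → Fin (n + 1) × Option (Fin (n + 1)) × (Fin 6 → Option (Fin (n + 1))) ×
      Cls n := fun G => (cx G, cy G, cg G, delV G (cx G))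
  have hF : Function.Injective F := by
    intro G1 G2 h
    simp only [F, Prod.mk.injEq] at h
    obtain ⟨e1, e2, e3, e4⟩ := h
    have h1 := hc G1
    have h2 := hc G2
    rw [← e1, ← e2, ← e3] at h2
    rw [← e1] at e4
    exact Subtype.ext (code_inj G1.1 G2.1 _ _ _ h1 h2 (congrArg Subtype.val e4))
  have := Nat.card_le_card_of_injective F hF
  rw [Nat.card_prod, Nat.card_prod, Nat.card_prod] at this
  simp only [Nat.card_eq_fintype_card, Fintype.card_option, Fintype.card_fin, Fintype.card_fun]
    at this
  refine this.trans ?_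
  calc (n + 1) * ((n + 1 + 1) * ((n + 1 + 1) ^ 6 * _)) ≤
        (n + 2) * ((n + 1 + 1) * ((n + 1 + 1) ^ 6 * _)) := Nat.mul_le_mul_right _ (by omega)
    _ = _ := by ring

lemma card_upper (n : ℕ) : Nat.card (Cls n) ≤ (n + 1) ^ (8 * n) := by
  induction n with
  | zero =>
    simp only [mul_zero, pow_zero]
    rw [Finite.card_le_one_iff_subsingleton]
    infer_instance
  | succ n ih =>
    calc Nat.card (Cls (n + 1)) ≤ (n + 2) ^ 8 * Nat.card (Cls n) := card_succ n
      _ ≤ (n + 2) ^ 8 * (n + 2) ^ (8 * n) :=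
        Nat.mul_le_mul_left _ (ih.trans (Nat.pow_le_pow_left (by omega) _))
      _ = (n + 1 + 1) ^ (8 * (n + 1)) := by ring

/-- A star forest with centres `0, …, k-1`. -/
def starF (n k : ℕ) (f : Fin (n - k) → Fin k) : SimpleGraph (Fin n) where
  Adj a b := ∃ i : Fin (n - k), (a.val = k + i.val ∧ b.val = (f i).val) ∨
    (b.val = k + i.val ∧ a.val = (f i).val)
  symm := ⟨fun _ _ ⟨i, h⟩ => ⟨i, h.symm⟩⟩
  loopless := ⟨fun a ⟨i, h⟩ => by
    have := (f i).isLt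
    omega⟩

lemma starF_no {n k : ℕ} (f : Fin (n - k) → Fin k) {W : Type*} {H : SimpleGraph W}
    (e : H ↪g starF n k f) {u v p q : W} (h1 : H.Adj u v) (h2 : H.Adj u p) (h3 : H.Adj v q)
    (n1 : p ≠ v) (n2 : q ≠ u) : False := by
  have uniq : ∀ a b c : Fin n, k ≤ a.val → (starF n k f).Adj a b → (starF n k f).Adj a c →
      b = c := by
    rintro a b c ha ⟨i, hi⟩ ⟨j, hj⟩
    have := (f i).isLt
    have := (f j).isLt
    have hij : i = j := by
      apply Fin.ext
      omega
    subst hij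
    apply Fin.ext
    omega
  have k1 := e.map_rel_iff.mpr h1
  have k2 := e.map_rel_iff.mpr h2
  have k3 := e.map_rel_iff.mpr h3
  by_cases hu : k ≤ (e u).val
  · exact n1 (e.injective (uniq _ _ _ hu k2 k1))
  · have hv : k ≤ (e v).val := by
      obtain ⟨i, hi⟩ := k1
      have := (f i).isLt
      change ((e u).val = _ ∧ _) ∨ ((e v).val = _ ∧ _) at hi
      omega
    exact n2 (e.injective (uniq _ _ _ hv k3 k1.symm))

lemma starF_mem (n k : ℕ) (f : Fin (n - k) → Fin k) :
    ChordalBipartite (starF n k f) ∧ ¬ Nonempty (Zgraph ↪g starF n k f) := by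
  refine ⟨⟨⟨Coloring.mk (fun a => if a.val < k then (0 : Fin 2) else 1) ?_⟩, ?_⟩, ?_⟩
  · rintro a b ⟨i, hi⟩
    have := (f i).isLt
    by_cases ha : a.val < k <;> by_cases hb : b.val < k <;> simp [ha, hb] <;> omega
  · rintro m hm ⟨e⟩
    obtain ⟨l, rfl⟩ : ∃ l, m = l + 2 := ⟨m - 2, by omega⟩
    have adj := fun i j => cyc_adj_val l i j (by omega)
    refine starF_no f e (u := ⟨0, by omega⟩) (v := ⟨1, by omega⟩) (p := ⟨l + 1, by omega⟩)
      (q := ⟨2, by omega⟩) ?_ ?_ ?_ ?_ ?_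
    · rw [adj]; simp
    · rw [adj]; simp
    · rw [adj]; simp
    · intro h
      have := congrArg Fin.val h
      simp at this
      omega
    · intro h
      have := congrArg Fin.val h
      simp at this
  · rintro ⟨e⟩
    refine starF_no f e (u := 0) (v := 1) (p := 3) (q := 2) ?_ ?_ ?_ ?_ ?_ <;> simp [Zgraph]

lemma card_lower (n k : ℕ) (hk : k ≤ n) : k ^ (n - k) ≤ Nat.card (Cls n) := by
  have hinj : Function.Injective (fun f : Fin (n - k) → Fin k =>
      (⟨starF n k f, starF_mem n k f⟩ : Cls n)) := by
    intro f g h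
    have h' : starF n k f = starF n k g := congrArg Subtype.val h
    funext i
    have hi := i.isLt
    have hfi := (f i).isLt
    have : (starF n k g).Adj ⟨k + i.val, by omega⟩ ⟨(f i).val, by omega⟩ := by
      rw [← h']
      exact ⟨i, Or.inl ⟨rfl, rfl⟩⟩
    obtain ⟨j, hj⟩ := this
    have hgj := (g j).isLt
    simp only at hj
    have hij : i = j := by
      apply Fin.ext
      omega
    subst hij
    apply Fin.ext
    omega
  have := Nat.card_le_card_of_injective _ hinj
  rwa [Nat.card_eq_fintype_card (α := Fin (n - k) → Fin k), Fintype.card_fun, Fintype.card_fin,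
    Fintype.card_fin] at this

/-- The class of `Z`-free chordal bipartite graphs is factorial: for all large `n`, the
number of labelled `Z`-free chordal bipartite graphs on `{1, …, n}` is between
`n^(c₁·n)` and `n^(c₂·n)`. -/
theorem statement17 :
    ∃ c₁ c₂ : ℝ, 0 < c₁ ∧ 0 < c₂ ∧ ∃ N : ℕ, ∀ n : ℕ, N ≤ n →
      (n : ℝ) ^ (c₁ * n) ≤
        (Nat.card {G : SimpleGraph (Fin n) //
          ChordalBipartite G ∧ ¬ Nonempty (Zgraph ↪g G)} : ℝ) ∧
      (Nat.card {G : SimpleGraph (Fin n) //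
          ChordalBipartite G ∧ ¬ Nonempty (Zgraph ↪g G)} : ℝ) ≤ (n : ℝ) ^ (c₂ * n) := by
  refine ⟨1 / 4, 16, by norm_num, by norm_num, 6, fun n hn => ⟨?_, ?_⟩⟩
  · obtain ⟨k, hk1, hk2⟩ : ∃ k, 2 * k ≤ n ∧ n ≤ 2 * k + 1 := ⟨n / 2, by omega, by omega⟩
    have hk3 : 3 ≤ k := by omega
    have hkn : n ≤ k ^ 2 := by nlinarith
    have h1 := card_lower n k (by omega)
    have h2 : ((k : ℝ)) ^ (n - k) ≤ (Nat.card (Cls n) : ℝ) := by exact_mod_cast h1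
    refine le_trans ?_ h2
    have hk0 : (0 : ℝ) ≤ k := Nat.cast_nonneg k
    have e1 : (n : ℝ) ^ ((1 : ℝ) / 4 * n) ≤ ((k : ℝ) ^ (2 : ℝ)) ^ ((1 : ℝ) / 4 * n) := by
      apply Real.rpow_le_rpow (Nat.cast_nonneg n) _ (by positivity)
      rw [Real.rpow_two]
      exact_mod_cast hkn
    refine e1.trans ?_
    rw [← Real.rpow_mul hk0, ← Real.rpow_natCast]
    apply Real.rpow_le_rpow_of_exponent_le
    · exact_mod_cast (by omega : 1 ≤ k)
    · rw [Nat.cast_sub (by omega)]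
      have : (2 : ℝ) * k ≤ n := by exact_mod_cast hk1
      linarith
  · have h1 : Nat.card (Cls n) ≤ n ^ (16 * n) := by
      refine (card_upper n).trans ?_
      have hn2 : n + 1 ≤ n ^ 2 := by nlinarith
      have h3 : (n + 1) ^ (8 * n) ≤ (n ^ 2) ^ (8 * n) := Nat.pow_le_pow_left hn2 _
      rw [← pow_mul, show 2 * (8 * n) = 16 * n by ring] at h3
      exact h3
    have h2 : (Nat.card (Cls n) : ℝ) ≤ (n : ℝ) ^ (16 * n) := by exact_mod_cast h1
    refine h2.trans (le_of_eq ?_)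
    rw [← Real.rpow_natCast]
    push_cast
    rfl
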